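/- Let δ : A → A be a derivation with δ(S_i) = S_i for all i = 1, …, n and δ(a*) = −δ(a)* for all a ∈ A. Then for all words μ, ν, applying δ entrywise to u_{μ,ν} = [[1 − P_μ, S_μ S_ν*],[S_ν S_μ*, 1 − P_ν]] ∈ M₂(A) and evaluating ψ on the matrix trace of u_{μ,ν}·δ(u_{μ,ν}), one obtains ψ((u_{μ,ν}·δ(u_{μ,ν}))₁₁) + ψ((u_{μ,ν}·δ(u_{μ,ν}))₂₂) = (|μ| − |ν|)·(n^{−|ν|} − n^{−|μ|}). -/

import Mathlib

/-- The product `S_μ = S_{μ₁} ⋯ S_{μ_k}` of a Cuntz family along a word `μ`. -/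
def cuntzWord {A : Type*} [Monoid A] {n : ℕ} (S : Fin n → A) (w : List (Fin n)) : A :=
  (w.map S).prod

theorem star_cuntzWord_mul_self {A : Type*} [Semiring A] [StarRing A] {n : ℕ} (S : Fin n → A)
    (hS : ∀ i, star (S i) * S i = 1) (w : List (Fin n)) :
    star (cuntzWord S w) * cuntzWord S w = 1 := by
  induction w with
  | nil => simp [cuntzWord]
  | cons i w ih =>
    have hcons : cuntzWord S (i :: w) = S i * cuntzWord S w := by simp [cuntzWord]
    rw [hcons, star_mul, mul_assoc, ← mul_assoc (star (S i)), hS, one_mul, ih]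

theorem derivation_one_eq_zero {A : Type*} [Ring A] (δ : A → A)
    (hder : ∀ a b : A, δ (a * b) = δ a * b + a * δ b) : δ 1 = 0 := by
  simpa using hder 1 1

theorem derivation_cuntzWord {A : Type*} [Ring A] [Algebra ℂ A] {n : ℕ} (S : Fin n → A)
    (δ : A → A) (hder : ∀ a b : A, δ (a * b) = δ a * b + a * δ b)
    (hδS : ∀ i, δ (S i) = S i) (w : List (Fin n)) :
    δ (cuntzWord S w) = (w.length : ℂ) • cuntzWord S w := by
  induction w with
  | nil => simp [cuntzWord, derivation_one_eq_zero δ hder]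
  | cons i w ih =>
    have hcons : cuntzWord S (i :: w) = S i * cuntzWord S w := by simp [cuntzWord]
    rw [hcons, hder, hδS, ih, mul_smul_comm, List.length_cons, Nat.cast_succ, add_smul,
      one_smul, add_comm]

theorem derivation_cuntzWord_mul_star {A : Type*} [Ring A] [Algebra ℂ A] [StarRing A]
    [StarModule ℂ A] {n : ℕ} (S : Fin n → A) (δ : A → A)
    (hder : ∀ a b : A, δ (a * b) = δ a * b + a * δ b) (hδS : ∀ i, δ (S i) = S i)
    (hδstar : ∀ a : A, δ (star a) = -star (δ a)) (μ ν : List (Fin n)) :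
    δ (cuntzWord S μ * star (cuntzWord S ν))
      = ((μ.length : ℂ) - (ν.length : ℂ)) • (cuntzWord S μ * star (cuntzWord S ν)) := by
  rw [hder, hδstar, derivation_cuntzWord S δ hder hδS, derivation_cuntzWord S δ hder hδS,
    star_smul, smul_mul_assoc, mul_neg, mul_smul_comm, sub_smul, sub_eq_add_neg]
  simp

/-- for a derivation `δ` with `δ(S_i) = S_i` and `δ(a*) = -δ(a)*`,
applying `δ` entrywise to `u_{μ,ν}` and taking `ψ` of the matrix trace of
`u_{μ,ν} δ(u_{μ,ν})` gives `(|μ| - |ν|)(n^{-|ν|} - n^{-|μ|})`. -/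
theorem stmt_15 {A : Type*} [Ring A] [Algebra ℂ A] [StarRing A] [StarModule ℂ A]
    {n : ℕ} (hn : 2 ≤ n) (S : Fin n → A)
    (hS1 : ∀ i j, star (S i) * S j = if i = j then 1 else 0)
    (hS2 : ∑ i, S i * star (S i) = 1)
    (ψ : A →ₗ[ℂ] ℂ)
    (hψ : ∀ μ ν : List (Fin n), ψ (cuntzWord S μ * star (cuntzWord S ν))
      = if μ = ν then (n : ℂ) ^ (-(μ.length : ℤ)) else 0)
    (δ : A →ₗ[ℂ] A)
    (hder : ∀ a b : A, δ (a * b) = δ a * b + a * δ b)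
    (hδS : ∀ i, δ (S i) = S i)
    (hδstar : ∀ a : A, δ (star a) = -star (δ a)) :
    ∀ μ ν : List (Fin n), ∀ u : Matrix (Fin 2) (Fin 2) A,
      u = !![1 - cuntzWord S μ * star (cuntzWord S μ),
              cuntzWord S μ * star (cuntzWord S ν);
              cuntzWord S ν * star (cuntzWord S μ),
              1 - cuntzWord S ν * star (cuntzWord S ν)] →
      ψ ((u * u.map (⇑δ)) 0 0) + ψ ((u * u.map (⇑δ)) 1 1)
        = ((μ.length : ℂ) - (ν.length : ℂ)) *
            ((n : ℂ) ^ (-(ν.length : ℤ)) - (n : ℂ) ^ (-(μ.length : ℤ))) := by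
  rintro μ ν u rfl
  have hδ := derivation_cuntzWord_mul_star S δ hder hδS hδstar
  have hP : ∀ w, δ (1 - cuntzWord S w * star (cuntzWord S w)) = 0 := fun w => by
    rw [map_sub, hδ, derivation_one_eq_zero δ hder, sub_self, zero_smul, sub_zero]
  have hcancel : ∀ v w, cuntzWord S v * star (cuntzWord S w) *
      (cuntzWord S w * star (cuntzWord S v)) = cuntzWord S v * star (cuntzWord S v) :=
    fun v w => by
      rw [mul_assoc, ← mul_assoc (star (cuntzWord S w)),
        star_cuntzWord_mul_self S (fun i => by simp [hS1]), one_mul]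
  simp only [Matrix.mul_apply, Fin.sum_univ_two, Matrix.map_apply, Matrix.of_apply,
    Matrix.cons_val_zero, Matrix.cons_val_one, Matrix.cons_val', Matrix.cons_val_fin_one,
    hP, hδ, mul_zero, zero_add, add_zero, mul_smul_comm, hcancel, map_smul, hψ, if_true,
    smul_eq_mul]
  ring
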